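/- arXiv:2104.07219 — 8 statements merged into one kernel-verified Lean document; each statement's English description precedes it below -/
import Mathlib

section
/- Let σ, λ : ℝ → ℝ be differentiable functions satisfying σ′(t) = λ(t) − 1/2 and λ′(t) = σ(t) − 1/2 for all t, with σ(0) = σ₀ and λ(0) = λ₀, and set c₁ = (1/2)σ₀ − 1/4, c₂ = (1/2)λ₀ − 1/4. Then for all t, σ(t) = (c₁ + c₂)e^t + (c₁ − c₂)e^{−t} + 1/2 and λ(t) = (c₁ + c₂)e^t + (c₂ − c₁)e^{−t} + 1/2; i.e., the solution of the single-task gradient flow with given initial conditions is unique and equal to this closed form. -/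
theorem stmt_3 (σ lam : ℝ → ℝ) (σ₀ lam₀ c₁ c₂ : ℝ)
    (hσ : ∀ t, HasDerivAt σ (lam t - 1/2) t)
    (hlam : ∀ t, HasDerivAt lam (σ t - 1/2) t)
    (hσ0 : σ 0 = σ₀) (hlam0 : lam 0 = lam₀)
    (hc₁ : c₁ = (1/2) * σ₀ - 1/4) (hc₂ : c₂ = (1/2) * lam₀ - 1/4) :
    ∀ t : ℝ,
      σ t = (c₁ + c₂) * Real.exp t + (c₁ - c₂) * Real.exp (-t) + 1/2 ∧
      lam t = (c₁ + c₂) * Real.exp t + (c₂ - c₁) * Real.exp (-t) + 1/2 := by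
  intro t
  have hexp : ∀ x : ℝ, HasDerivAt (fun x : ℝ => Real.exp (-x)) (Real.exp (-x) * (-1)) x :=
    fun x => (hasDerivAt_neg x).exp
  have hu : ∀ x, HasDerivAt (fun x => (σ x + lam x - 1) * Real.exp (-x)) 0 x := by
    intro x
    have h := (((hσ x).fun_add (hlam x)).sub_const 1).fun_mul (hexp x)
    refine h.congr_deriv ?_
    ring
  have hv : ∀ x, HasDerivAt (fun x => (σ x - lam x) * Real.exp x) 0 x := by
    intro x
    have h := ((hσ x).fun_sub (hlam x)).fun_mul (Real.hasDerivAt_exp x)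
    refine h.congr_deriv ?_
    ring
  have h1 := is_const_of_deriv_eq_zero (fun x => (hu x).differentiableAt)
    (fun x => (hu x).deriv) t 0
  have h2 := is_const_of_deriv_eq_zero (fun x => (hv x).differentiableAt)
    (fun x => (hv x).deriv) t 0
  simp only [hσ0, hlam0, neg_zero, Real.exp_zero, mul_one] at h1 h2
  have he : Real.exp t * Real.exp (-t) = 1 := by
    rw [← Real.exp_add]; simp
  have e1 : σ t + lam t - 1 = (σ₀ + lam₀ - 1) * Real.exp t := by
    linear_combination Real.exp t * h1 - (σ t + lam t - 1) * he
  have e2 : σ t - lam t = (σ₀ - lam₀) * Real.exp (-t) := by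
    linear_combination Real.exp (-t) * h2 - (σ t - lam t) * he
  subst hc₁ hc₂
  constructor
  · linear_combination (e1 + e2) / 2
  · linear_combination (e1 - e2) / 2
end

section
/- Let σ, λ : ℝ → ℝ be differentiable functions satisfying σ′(t) = λ(t) − 1/2 and λ′(t) = σ(t) − 1/2 for all t, with σ(0) = σ₀ ∈ (0,1), λ(0) = λ₀ ∈ (0,1), and σ₀ + λ₀ < 1. Then for all t ≥ 0, σ(t) < 1 and λ(t) < 1; i.e., neither parameter ever reaches the value 1 along the forward trajectory. -/
theorem stmt_8 (σ lam : ℝ → ℝ) (σ₀ lam₀ : ℝ)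
    (hσ : ∀ t, HasDerivAt σ (lam t - 1/2) t)
    (hlam : ∀ t, HasDerivAt lam (σ t - 1/2) t)
    (hσ0 : σ 0 = σ₀) (hlam0 : lam 0 = lam₀)
    (hσ0mem : σ₀ ∈ Set.Ioo (0:ℝ) 1) (hlam0mem : lam₀ ∈ Set.Ioo (0:ℝ) 1)
    (hinit : σ₀ + lam₀ < 1) :
    ∀ t : ℝ, 0 ≤ t → σ t < 1 ∧ lam t < 1 := by
  intro t ht
  obtain ⟨h1, h2⟩ := hσ0mem
  obtain ⟨h3, h4⟩ := hlam0mem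
  have hu : ∀ x, HasDerivAt (fun s => (σ s + lam s - 1) * Real.exp (-s)) 0 x := by
    intro x
    have h := (((hσ x).add (hlam x)).sub_const 1).mul ((hasDerivAt_id x).neg.exp)
    refine h.congr_deriv ?_
    simp
    ring
  have hv : ∀ x, HasDerivAt (fun s => (σ s - lam s) * Real.exp s) 0 x := by
    intro x
    have h := ((hσ x).sub (hlam x)).mul (Real.hasDerivAt_exp x)
    refine h.congr_deriv ?_
    simp
    ring
  have hu' := is_const_of_deriv_eq_zero (fun x => (hu x).differentiableAt)
    (fun x => (hu x).deriv) t 0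
  have hv' := is_const_of_deriv_eq_zero (fun x => (hv x).differentiableAt)
    (fun x => (hv x).deriv) t 0
  simp only [neg_zero, Real.exp_zero, mul_one, hσ0, hlam0] at hu' hv'
  have he : 1 ≤ Real.exp t := Real.one_le_exp ht
  have hp : 0 < Real.exp (-t) := Real.exp_pos _
  have k1 : σ t + lam t - 1 < 0 := by
    by_contra hc
    push Not at hc
    have := mul_nonneg hc hp.le
    linarith
  have k2 : σ t - lam t < 1 := by
    by_contra hc
    push Not at hc
    nlinarith
  have k3 : -1 < σ t - lam t := by
    by_contra hc
    push Not at hc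
    nlinarith
  constructor <;> linarith
end

section
/- Let σ, λ : ℝ → ℝ be differentiable functions satisfying σ′(t) = λ(t) − 1/2 and λ′(t) = σ(t) − 1/2 for all t, with σ(0) = σ₀ ∈ (0,1), λ(0) = λ₀ ∈ (0,1), and σ₀ + λ₀ > 1. Then σ(t) → +∞ and λ(t) → +∞ as t → +∞, and there exists t > 0 with λ(t) = 1 (the executor parameter reaches 1 in finite time, so semantic drift is avoided). -/
theorem stmt_9 (σ lam : ℝ → ℝ) (σ₀ lam₀ : ℝ)
    (hσ : ∀ t, HasDerivAt σ (lam t - 1/2) t)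
    (hlam : ∀ t, HasDerivAt lam (σ t - 1/2) t)
    (hσ0 : σ 0 = σ₀) (hlam0 : lam 0 = lam₀)
    (hσ0mem : σ₀ ∈ Set.Ioo (0:ℝ) 1) (hlam0mem : lam₀ ∈ Set.Ioo (0:ℝ) 1)
    (hinit : 1 < σ₀ + lam₀) :
    Filter.Tendsto σ Filter.atTop Filter.atTop ∧
    Filter.Tendsto lam Filter.atTop Filter.atTop ∧
    ∃ t : ℝ, 0 < t ∧ lam t = 1 := by
  obtain ⟨a1, a2⟩ := hσ0mem
  obtain ⟨b1, b2⟩ := hlam0mem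
  have key : ∀ (f : ℝ → ℝ), (∀ t, HasDerivAt f 0 t) → ∀ t, f t = f 0 := fun f hf t =>
    is_const_of_deriv_eq_zero (fun t => (hf t).differentiableAt) (fun t => (hf t).deriv) t 0
  have hE : ∀ t : ℝ, Real.exp (-t) * Real.exp t = 1 := fun t => by
    rw [← Real.exp_add]; simp
  have hn : ∀ t : ℝ, HasDerivAt (fun s : ℝ => Real.exp (-s)) (-Real.exp (-t)) t := fun t => by
    simpa using (hasDerivAt_neg t).exp
  have hu : ∀ t, σ t + lam t - 1 = (σ₀ + lam₀ - 1) * Real.exp t := by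
    intro t
    have h := key (fun s => (σ s + lam s - 1) * Real.exp (-s)) (fun t => by
      have h := (((hσ t).add (hlam t)).sub_const 1).mul (hn t)
      refine h.congr_deriv ?_
      simp only [Pi.add_apply]
      ring) t
    simp only [neg_zero, Real.exp_zero, mul_one, hσ0, hlam0] at h
    rw [← h, mul_assoc, hE, mul_one]
  have hv : ∀ t, σ t - lam t = (σ₀ - lam₀) * Real.exp (-t) := by
    intro t
    have h := key (fun s => (σ s - lam s) * Real.exp s) (fun t => by
      have h := ((hσ t).sub (hlam t)).mul (Real.hasDerivAt_exp t)
      refine h.congr_deriv ?_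
      simp only [Pi.sub_apply]
      ring) t
    simp only [Real.exp_zero, mul_one, hσ0, hlam0] at h
    rw [← h, mul_assoc, mul_comm (Real.exp t), hE, mul_one]
  have hT : Filter.Tendsto (fun t => (σ₀ + lam₀ - 1) / 2 * Real.exp t)
      Filter.atTop Filter.atTop :=
    Real.tendsto_exp_atTop.const_mul_atTop (by linarith)
  have hle : ∀ t : ℝ, 0 ≤ t → Real.exp (-t) ≤ 1 := fun t ht => by
    rw [Real.exp_le_one_iff]; linarith
  have hlamT : Filter.Tendsto lam Filter.atTop Filter.atTop := by
    refine Filter.tendsto_atTop_mono' _ ?_ hT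
    filter_upwards [Filter.eventually_ge_atTop 0] with t ht
    have := hle t ht
    have := Real.exp_pos (-t)
    nlinarith [hu t, hv t]
  refine ⟨?_, hlamT, ?_⟩
  · refine Filter.tendsto_atTop_mono' _ ?_ hT
    filter_upwards [Filter.eventually_ge_atTop 0] with t ht
    have := hle t ht
    have := Real.exp_pos (-t)
    nlinarith [hu t, hv t]
  · obtain ⟨T, h1, h0⟩ :=
      ((hlamT.eventually_ge_atTop 1).and (Filter.eventually_ge_atTop 0)).exists
    have hc : Continuous lam :=
      continuous_iff_continuousAt.2 fun t => (hlam t).continuousAt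
    obtain ⟨t, ht, h⟩ := intermediate_value_Icc h0 hc.continuousOn
      (show (1:ℝ) ∈ Set.Icc (lam 0) (lam T) from ⟨by linarith, h1⟩)
    refine ⟨t, lt_of_le_of_ne ht.1 ?_, h⟩
    rintro rfl
    linarith
end

section
/- Let σ₀, λ₀ be real numbers. Then the functions σ₁(t) = σ₀ + (√2/2)·(λ₀ − 1/2)·sinh(t/√2), σ₂(t) = σ₀ − (√2/2)·(λ₀ − 1/2)·sinh(t/√2), and λ(t) = (λ₀ − 1/2)·cosh(t/√2) + 1/2 satisfy σ₁(0) = σ₂(0) = σ₀, λ(0) = λ₀, and for all real t: σ₁′(t) = (1/2)λ(t) − 1/4, σ₂′(t) = −(1/2)λ(t) + 1/4, and λ′(t) = (1/2)(σ₁(t) − σ₂(t)). -/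
theorem stmt_11 (σ₀ lam₀ : ℝ) (σ₁ σ₂ lam : ℝ → ℝ)
    (hσ₁def : ∀ t, σ₁ t = σ₀ + (Real.sqrt 2 / 2) * (lam₀ - 1/2) * Real.sinh (t / Real.sqrt 2))
    (hσ₂def : ∀ t, σ₂ t = σ₀ - (Real.sqrt 2 / 2) * (lam₀ - 1/2) * Real.sinh (t / Real.sqrt 2))
    (hlamdef : ∀ t, lam t = (lam₀ - 1/2) * Real.cosh (t / Real.sqrt 2) + 1/2) :
    σ₁ 0 = σ₀ ∧ σ₂ 0 = σ₀ ∧ lam 0 = lam₀ ∧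
    ∀ t : ℝ,
      HasDerivAt σ₁ ((1/2) * lam t - 1/4) t ∧
      HasDerivAt σ₂ (-(1/2) * lam t + 1/4) t ∧
      HasDerivAt lam ((1/2) * (σ₁ t - σ₂ t)) t := by
  have h2 : Real.sqrt 2 * Real.sqrt 2 = 2 := Real.mul_self_sqrt (by norm_num)
  have hinv : 1 / Real.sqrt 2 = Real.sqrt 2 / 2 := by
    have h0 : Real.sqrt 2 ≠ 0 := by positivity
    rw [div_eq_div_iff h0 (by norm_num)]
    linarith
  have e1 := funext hσ₁def
  have e2 := funext hσ₂def
  have e3 := funext hlamdef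
  refine ⟨by simp [hσ₁def], by simp [hσ₂def], by simp [hlamdef], fun t => ?_⟩
  have hd : HasDerivAt (fun t : ℝ => t / Real.sqrt 2) (Real.sqrt 2 / 2) t := by
    rw [← hinv]
    exact (hasDerivAt_id t).div_const _
  have hs := hd.sinh.const_mul ((Real.sqrt 2 / 2) * (lam₀ - 1/2))
  have hc := (hd.cosh.const_mul (lam₀ - 1/2)).add_const (1/2)
  refine ⟨?_, ?_, ?_⟩
  · rw [hlamdef t, e1]
    refine (hs.const_add σ₀).congr_deriv ?_
    linear_combination (1/4 * (lam₀ - 1/2) * Real.cosh (t / Real.sqrt 2)) * h2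
  · rw [hlamdef t, e2]
    refine (hs.const_sub σ₀).congr_deriv ?_
    linear_combination (-1/4 * (lam₀ - 1/2) * Real.cosh (t / Real.sqrt 2)) * h2
  · rw [hσ₁def t, hσ₂def t, e3]
    refine hc.congr_deriv ?_
    ring
end

section
/- (Proposition 2, closed form.) Let σ₁, σ₂, λ : ℝ → ℝ be differentiable functions satisfying σ₁′(t) = (1/2)λ(t) − 1/4, σ₂′(t) = −(1/2)λ(t) + 1/4, and λ′(t) = (1/2)(σ₁(t) − σ₂(t)) for all t, with σ₁(0) = σ₂(0) and λ(0) = λ₀. Then for all t, λ(t) = (λ₀ − 1/2)·cosh(t/√2) + 1/2; in particular, the executor trajectory λ(t) is independent of the common initial instructor parameter σ₁(0) = σ₂(0). -/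
theorem exp_ode_aux (f : ℝ → ℝ) (c : ℝ) (h : ∀ t, HasDerivAt f (c * f t) t) (t : ℝ) :
    f t = f 0 * Real.exp (c * t) := by
  have hg : ∀ x, HasDerivAt (fun y => f y * Real.exp (-(c * y))) 0 x := by
    intro x
    have h1 : HasDerivAt (fun y : ℝ => -(c * y)) (-(c * 1)) x :=
      ((hasDerivAt_id x).const_mul c).neg
    have h2 := (h x).mul h1.exp
    refine h2.congr_deriv ?_
    ring
  have hc := is_const_of_deriv_eq_zero (fun x => (hg x).differentiableAt)
    (fun x => (hg x).deriv) t 0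
  simp only [mul_zero, neg_zero, Real.exp_zero, mul_one] at hc
  rw [← hc, mul_assoc, ← Real.exp_add]
  simp

theorem stmt_15 (σ₁ σ₂ lam : ℝ → ℝ) (lam₀ : ℝ)
    (hσ₁ : ∀ t, HasDerivAt σ₁ ((1/2) * lam t - 1/4) t)
    (hσ₂ : ∀ t, HasDerivAt σ₂ (-(1/2) * lam t + 1/4) t)
    (hlam : ∀ t, HasDerivAt lam ((1/2) * (σ₁ t - σ₂ t)) t)
    (hinit : σ₁ 0 = σ₂ 0) (hlam0 : lam 0 = lam₀) :
    ∀ t : ℝ, lam t = (lam₀ - 1/2) * Real.cosh (t / Real.sqrt 2) + 1/2 := by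
  intro t
  have key : ∀ c : ℝ, c * c = 1/2 →
      lam t - 1/2 + c * (σ₁ t - σ₂ t) = (lam₀ - 1/2) * Real.exp (c * t) := by
    intro c hc
    have := exp_ode_aux (fun y => lam y - 1/2 + c * (σ₁ y - σ₂ y)) c (fun x => by
      refine (((hlam x).sub_const (1/2)).add
        (((hσ₁ x).sub (hσ₂ x)).const_mul c)).congr_deriv ?_
      linear_combination (-(σ₁ x - σ₂ x)) * hc) t
    simpa [hinit, hlam0] using this
  have hs : (Real.sqrt 2)⁻¹ * (Real.sqrt 2)⁻¹ = 1/2 := by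
    rw [← mul_inv, Real.mul_self_sqrt (by norm_num)]; norm_num
  have h1 := key _ hs
  have h2 := key (-(Real.sqrt 2)⁻¹) (by rw [neg_mul_neg, hs])
  rw [Real.cosh_eq, show t / Real.sqrt 2 = (Real.sqrt 2)⁻¹ * t by ring, ← neg_mul]
  linear_combination (h1 + h2) / 2
end

section
/- (Proposition 2, no semantic drift.) Let σ₁, σ₂, λ : ℝ → ℝ be differentiable functions satisfying σ₁′(t) = (1/2)λ(t) − 1/4, σ₂′(t) = −(1/2)λ(t) + 1/4, and λ′(t) = (1/2)(σ₁(t) − σ₂(t)) for all t, with σ₁(0) = σ₂(0) and λ(0) = λ₀ > 1/2. Then λ(t) ≥ λ₀ > 1/2 for all t ≥ 0, λ is strictly increasing on (0, ∞), and λ(t) → +∞ as t → +∞; in particular the multitask flow never undergoes executor semantic drift. -/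
theorem lin_ode (y : ℝ → ℝ) (c : ℝ) (h : ∀ t, HasDerivAt y (c * y t) t) (t : ℝ) :
    y t = y 0 * Real.exp (c * t) := by
  have hd : ∀ s, HasDerivAt (fun s => y s * Real.exp (-(c * s))) 0 s := by
    intro s
    have h1 : HasDerivAt (fun s : ℝ => -(c * s)) (-c) s := by
      exact (((hasDerivAt_id s).const_mul c).neg).congr_deriv (by ring)
    have h2 := (h s).mul h1.exp
    exact h2.congr_deriv (by ring)
  have h3 := is_const_of_deriv_eq_zero (fun s => (hd s).differentiableAt)
    (fun s => (hd s).deriv) t 0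
  simp only [mul_zero, neg_zero, Real.exp_zero, mul_one] at h3
  rw [← h3, mul_assoc, ← Real.exp_add]
  simp

theorem stmt_16 (σ₁ σ₂ lam : ℝ → ℝ) (lam₀ : ℝ)
    (hσ₁ : ∀ t, HasDerivAt σ₁ ((1/2) * lam t - 1/4) t)
    (hσ₂ : ∀ t, HasDerivAt σ₂ (-(1/2) * lam t + 1/4) t)
    (hlam : ∀ t, HasDerivAt lam ((1/2) * (σ₁ t - σ₂ t)) t)
    (hinit : σ₁ 0 = σ₂ 0) (hlam0 : lam 0 = lam₀) (hlam₀ : 1/2 < lam₀) :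
    (∀ t : ℝ, 0 ≤ t → lam₀ ≤ lam t) ∧
    StrictMonoOn lam (Set.Ioi (0:ℝ)) ∧
    Filter.Tendsto lam Filter.atTop Filter.atTop := by
  obtain ⟨c, hc, hc2⟩ : ∃ c : ℝ, 0 < c ∧ c * c = 1/2 :=
    ⟨Real.sqrt (1/2), by positivity, Real.mul_self_sqrt (by norm_num)⟩
  have key : ∀ e : ℝ, e * e = 1/2 → ∀ t,
      σ₁ t - σ₂ t + 2 * e * (lam t - 1/2) = 2 * e * (lam₀ - 1/2) * Real.exp (e * t) := by
    intro e he t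
    have := lin_ode (fun t => σ₁ t - σ₂ t + 2 * e * (lam t - 1/2)) e (by
      intro t
      have h := ((hσ₁ t).sub (hσ₂ t)).add (((hlam t).sub_const (1/2)).const_mul (2 * e))
      refine h.congr_deriv ?_
      linear_combination (-2 * (lam t - 1/2)) * he) t
    simpa [hinit, hlam0] using this
  have hsol : ∀ t, lam t = 1/2 + (lam₀ - 1/2) * Real.cosh (c * t) := by
    intro t
    have h1 := key c hc2 t
    have h2 := key (-c) (by linarith) t
    rw [Real.cosh_eq, ← neg_mul]
    have h3 : 4 * c * (lam t - (1/2 + (lam₀ - 1/2) *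
        ((Real.exp (c * t) + Real.exp (-c * t)) / 2))) = 0 := by
      linear_combination h1 - h2
    have : (4 * c) ≠ 0 := by positivity
    linarith [(mul_eq_zero.mp h3).resolve_left this]
  have hm : 0 < lam₀ - 1/2 := by linarith
  refine ⟨fun t _ => ?_, fun x hx y hy hxy => ?_, ?_⟩
  · rw [hsol t]
    nlinarith [Real.one_le_cosh (c * t)]
  · rw [hsol x, hsol y]
    have hx' : 0 < x := hx
    have hy' : 0 < y := hy
    have : Real.cosh (c * x) < Real.cosh (c * y) := by
      rw [Real.cosh_lt_cosh, abs_of_pos (by positivity), abs_of_pos (by positivity)]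
      exact mul_lt_mul_of_pos_left hxy hc
    nlinarith
  · have h1 : Filter.Tendsto (fun t => (lam₀ - 1/2) / 2 * Real.exp (c * t))
        Filter.atTop Filter.atTop :=
      (Real.tendsto_exp_atTop.comp (Filter.tendsto_id.const_mul_atTop hc)).const_mul_atTop
        (by positivity)
    refine Filter.tendsto_atTop_mono (fun t => ?_) h1
    rw [hsol t, Real.cosh_eq]
    nlinarith [mul_pos hm (Real.exp_pos (-(c * t)))]
end

section
/- Let σ, λ : ℝ → ℝ be differentiable functions satisfying σ′(t) = λ(t) − 1/2 and λ′(t) = σ(t) − 1/2 for all t, with σ(0) = σ₀ ∈ (0,1), λ(0) = λ₀ ∈ (0,1), and σ₀ + λ₀ < 1. Then there exists t > 0 such that λ(t) = 0 or σ(t) = 0 while both σ(s) < 1 and λ(s) < 1 for all s in [0, t]; i.e., the trajectory exits the unit square through the faces {σ = 0} ∪ {λ = 0}. -/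
theorem stmt_18 (σ lam : ℝ → ℝ) (σ₀ lam₀ : ℝ)
    (hσ : ∀ t, HasDerivAt σ (lam t - 1/2) t)
    (hlam : ∀ t, HasDerivAt lam (σ t - 1/2) t)
    (hσ0 : σ 0 = σ₀) (hlam0 : lam 0 = lam₀)
    (hσ0mem : σ₀ ∈ Set.Ioo (0:ℝ) 1) (hlam0mem : lam₀ ∈ Set.Ioo (0:ℝ) 1)
    (hinit : σ₀ + lam₀ < 1) :
    ∃ t : ℝ, 0 < t ∧ (lam t = 0 ∨ σ t = 0) ∧
      ∀ s ∈ Set.Icc (0:ℝ) t, σ s < 1 ∧ lam s < 1 := by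
  obtain ⟨a1, a2⟩ := hσ0mem
  obtain ⟨b1, b2⟩ := hlam0mem
  have hE : ∀ t, HasDerivAt (fun t : ℝ => Real.exp (-t)) (Real.exp (-t) * (-1)) t :=
    fun t => (hasDerivAt_neg t).exp
  have hu : ∀ t, (σ t + lam t - 1) * Real.exp (-t) = σ₀ + lam₀ - 1 := by
    intro t
    have hd : ∀ t, HasDerivAt (fun t => (σ t + lam t - 1) * Real.exp (-t)) 0 t := by
      intro t
      refine ((((hσ t).add (hlam t)).sub_const 1).mul (hE t)).congr_deriv ?_
      simp only [Pi.add_apply]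
      ring
    have := is_const_of_deriv_eq_zero (fun t => (hd t).differentiableAt)
      (fun t => (hd t).deriv) t 0
    simpa [hσ0, hlam0] using this
  have hv : ∀ t, (σ t - lam t) * Real.exp t = σ₀ - lam₀ := by
    intro t
    have hd : ∀ t, HasDerivAt (fun t => (σ t - lam t) * Real.exp t) 0 t := by
      intro t
      refine (((hσ t).sub (hlam t)).mul (Real.hasDerivAt_exp t)).congr_deriv ?_
      simp only [Pi.sub_apply]
      ring
    have := is_const_of_deriv_eq_zero (fun t => (hd t).differentiableAt)
      (fun t => (hd t).deriv) t 0
    simpa [hσ0, hlam0] using this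
  have hc : Continuous (fun t => min (σ t) (lam t)) :=
    (continuous_iff_continuousAt.2 fun t => (hσ t).continuousAt).min
      (continuous_iff_continuousAt.2 fun t => (hlam t).continuousAt)
  set T := -Real.log (1 - σ₀ - lam₀) with hT
  have hT0 : 0 ≤ T := by
    have := Real.log_nonpos (x := 1 - σ₀ - lam₀) (by linarith) (by linarith)
    linarith
  have hsum : σ T + lam T = 0 := by
    have h := hu T
    rw [hT, neg_neg, Real.exp_log (by linarith), ← hT] at h
    have : (σ T + lam T) * (1 - σ₀ - lam₀) = 0 := by linarith
    rcases mul_eq_zero.1 this with h | h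
    · exact h
    · linarith
  have hm : min (σ T) (lam T) ≤ 0 := by
    rcases le_total (σ T) 0 with h | h
    · exact (min_le_left _ _).trans h
    · exact (min_le_right _ _).trans (by linarith)
  obtain ⟨t, ht, ht0⟩ := intermediate_value_Icc' hT0 hc.continuousOn
    (show (0:ℝ) ∈ Set.Icc _ _ from ⟨hm, by simp [hσ0, hlam0, a1.le, b1.le]⟩)
  refine ⟨t, ?_, ?_, ?_⟩
  · rcases ht.1.lt_or_eq with h | h
    · exact h
    · subst h
      have : 0 < min (σ 0) (lam 0) := by rw [hσ0, hlam0]; exact lt_min a1 b1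
      simp only at ht0
      linarith
  · simp only at ht0
    rcases min_choice (σ t) (lam t) with h | h
    · right; linarith
    · left; linarith
  · intro s hs
    have h1 : σ s + lam s < 1 := by
      by_contra hcon
      have := mul_nonneg (show 0 ≤ σ s + lam s - 1 by linarith) (Real.exp_pos (-s)).le
      have := hu s
      linarith
    have he : 1 ≤ Real.exp s := Real.one_le_exp hs.1
    have h2 : σ s - lam s < 1 := by
      by_contra hcon
      have := hv s
      nlinarith
    have h3 : lam s - σ s < 1 := by
      by_contra hcon
      have := hv s
      nlinarith
    constructor <;> linarith
end

section
/- Let σ, λ : ℝ → ℝ be differentiable functions satisfying σ′(t) = λ(t) − 1/2 and λ′(t) = σ(t) − 1/2 for all t, with σ(0) = σ₀ ∈ (0,1) and λ(0) = λ₀ ∈ (0,1). Then there exists t > 0 with σ(t) = 1 or λ(t) = 1 if and only if σ₀ + λ₀ > 1. -/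
theorem stmt_19 (σ lam : ℝ → ℝ) (σ₀ lam₀ : ℝ)
    (hσ : ∀ t, HasDerivAt σ (lam t - 1/2) t)
    (hlam : ∀ t, HasDerivAt lam (σ t - 1/2) t)
    (hσ0 : σ 0 = σ₀) (hlam0 : lam 0 = lam₀)
    (hσ0mem : σ₀ ∈ Set.Ioo (0:ℝ) 1) (hlam0mem : lam₀ ∈ Set.Ioo (0:ℝ) 1) :
    (∃ t : ℝ, 0 < t ∧ (σ t = 1 ∨ lam t = 1)) ↔ 1 < σ₀ + lam₀ := by
  obtain ⟨ha, hb⟩ := hσ0mem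
  obtain ⟨hc, hd⟩ := hlam0mem
  have hu : ∀ t, (σ t + lam t - 1) * Real.exp (-t) = σ₀ + lam₀ - 1 := by
    intro t
    have hder : ∀ x, HasDerivAt (fun t => (σ t + lam t - 1) * Real.exp (-t)) 0 x := by
      intro x
      have h := (((hσ x).add (hlam x)).sub_const 1).mul ((hasDerivAt_neg x).exp)
      refine h.congr_deriv ?_
      simp only [Pi.add_apply]
      ring
    have h := is_const_of_deriv_eq_zero (fun x => (hder x).differentiableAt)
      (fun x => (hder x).deriv) t 0
    simpa [hσ0, hlam0] using h
  have hv : ∀ t, (σ t - lam t) * Real.exp t = σ₀ - lam₀ := by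
    intro t
    have hder : ∀ x, HasDerivAt (fun t => (σ t - lam t) * Real.exp t) 0 x := by
      intro x
      have h := ((hσ x).sub (hlam x)).mul (Real.hasDerivAt_exp x)
      refine h.congr_deriv ?_
      simp only [Pi.sub_apply]
      ring
    have h := is_const_of_deriv_eq_zero (fun x => (hder x).differentiableAt)
      (fun x => (hder x).deriv) t 0
    simpa [hσ0, hlam0] using h
  have hvb : ∀ t, 0 < t → σ t - lam t < 1 ∧ -1 < σ t - lam t := by
    intro t ht
    have h1 := Real.one_lt_exp_iff.mpr ht
    have h2 := hv t
    constructor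
    · by_contra! h
      nlinarith
    · by_contra! h
      nlinarith
  constructor
  · rintro ⟨t, ht, h⟩
    by_contra! hle
    have h1 := hvb t ht
    have h2 : σ t + lam t - 1 ≤ 0 := by
      by_contra! h3
      have := mul_pos h3 (Real.exp_pos (-t))
      linarith [hu t]
    rcases h with h | h <;> linarith [h1.1, h1.2]
  · intro hpos
    have hw : 0 < σ₀ + lam₀ - 1 := by linarith
    set T := 2 / (σ₀ + lam₀ - 1) with hT
    have hTpos : 0 < T := by positivity
    have h1 := hvb T hTpos
    have h2 : 2 ≤ σ T + lam T - 1 := by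
      have h3 : σ T + lam T - 1 = (σ₀ + lam₀ - 1) * Real.exp T := by
        rw [← hu T, mul_assoc, ← Real.exp_add]; simp
      have h4 : (σ₀ + lam₀ - 1) * T = 2 := by rw [hT]; field_simp
      nlinarith [Real.add_one_le_exp T]
    have hcont : ContinuousOn σ (Set.Icc 0 T) :=
      fun x _ => (hσ x).continuousAt.continuousWithinAt
    obtain ⟨t, ht, hte⟩ := intermediate_value_Icc hTpos.le hcont
      (show (1:ℝ) ∈ Set.Icc (σ 0) (σ T) from ⟨by linarith, by linarith [h1.2]⟩)
    refine ⟨t, lt_of_le_of_ne ht.1 ?_, Or.inl hte⟩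
    rintro rfl
    linarith
end
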